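/- Let u and v be vertices of G_α that are directly connected by a shortcut edge, and let ω̃ be any path-oblivious 1-rounding of G_α. Then the single-edge path consisting of the shortcut edge {u,v} is the unique shortest path from u to v in G_α, both with respect to the original weights ω and with respect to the rounded weights ω̃. -/

import Mathlib

open SimpleGraph

/-! ## Generic shortest-path and rounding definitions -/

noncomputable def wWeight {V : Type*} {G : SimpleGraph V} (w : V → V → ℝ) {u v : V}
    (p : G.Walk u v) : ℝ :=
  (p.darts.map (fun d => w d.toProd.1 d.toProd.2)).sum

def IsShortestPath {V : Type*} {G : SimpleGraph V} (w : V → V → ℝ) {u v : V}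
    (p : G.Walk u v) : Prop :=
  p.IsPath ∧ ∀ q : G.Walk u v, wWeight w p ≤ wWeight w q

def PathObliviousRounding {V : Type*} (G : SimpleGraph V) (w : V → V → ℝ) (wt : V → V → ℕ)
    (ε : ℝ) : Prop :=
  ∀ (u v : V) (p : G.Walk u v), IsShortestPath w p →
    |wWeight (fun a b => (wt a b : ℝ)) p - wWeight w p| < ε

def WeakRounding {V : Type*} (G : SimpleGraph V) (w : V → V → ℝ) (wt : V → V → ℕ)
    (ε : ℝ) : Prop :=
  PathObliviousRounding G w wt ε ∧
  ∀ (u v : V) (p : G.Walk u v), IsShortestPath w p →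
    IsShortestPath (fun a b => (wt a b : ℝ)) p

def StrongRounding {V : Type*} (G : SimpleGraph V) (w : V → V → ℝ) (wt : V → V → ℕ)
    (ε : ℝ) : Prop :=
  WeakRounding G w wt ε ∧
  ∀ (u v : V) (p : G.Walk u v), IsShortestPath (fun a b => (wt a b : ℝ)) p →
    IsShortestPath w p

/-! ## The construction of `G_α`

A 3-CNF formula `α` with `m` clauses over `n` variables is given by
`C : Fin m → Fin 3 → Fin n × Bool`: the `t`-th literal of clause `j` is the variable
`(C j t).1` with polarity `(C j t).2` (`true` = positive literal, `false` = negated). -/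

variable {n m : ℕ}

/-- The occurrences of variable `i` in `α`, as the lexicographically ordered list of
pairs `(j, t)` such that the `t`-th literal of clause `j` involves `x_i`. -/
def occs (C : Fin m → Fin 3 → Fin n × Bool) (i : Fin n) : List (Fin m × Fin 3) :=
  ((List.finRange m).product (List.finRange 3)).filter (fun q => (C q.1 q.2).1 = i)

/-- The number `h` of literals of `α` involving variable `i`. -/
def hocc (C : Fin m → Fin 3 → Fin n × Bool) (i : Fin n) : ℕ := (occs C i).length

/-- The vertices of the variable gadget for `x_i`: for each occurrence `k` a triangle
`Δ_{i,k}` with left (`0`), right (`1`) and base (`2`) vertex; two pendant vertices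
(`false` = `v_{i,0}`, `true` = `v_{i,h+1}`); and an inverter vertex for each negated
occurrence. -/
def VarV (C : Fin m → Fin 3 → Fin n × Bool) (i : Fin n) : Type :=
  (Fin (hocc C i) × Fin 3) ⊕
    (Bool ⊕ {k : Fin (hocc C i) //
      (C ((occs C i).get k).1 ((occs C i).get k).2).2 = false})

/-- The vertices of the clause gadget for `C_j`: a nine-cycle, three knobs, and a centre. -/
def ClauseV : Type := (Fin 9 ⊕ Fin 3) ⊕ Unit

/-- The vertex set of `G_α`. -/
def GV (C : Fin m → Fin 3 → Fin n × Bool) : Type :=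
  (Σ i : Fin n, VarV C i) ⊕ (Fin m × ClauseV)

def vtri (C : Fin m → Fin 3 → Fin n × Bool) (i : Fin n) (k : Fin (hocc C i)) (x : Fin 3) :
    GV C := Sum.inl ⟨i, Sum.inl (k, x)⟩

def vpend (C : Fin m → Fin 3 → Fin n × Bool) (i : Fin n) (b : Bool) : GV C :=
  Sum.inl ⟨i, Sum.inr (Sum.inl b)⟩

def vinv (C : Fin m → Fin 3 → Fin n × Bool) (i : Fin n) (k : Fin (hocc C i))
    (hk : (C ((occs C i).get k).1 ((occs C i).get k).2).2 = false) : GV C :=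
  Sum.inl ⟨i, Sum.inr (Sum.inr ⟨k, hk⟩)⟩

def ccyc (C : Fin m → Fin 3 → Fin n × Bool) (j : Fin m) (s : Fin 9) : GV C :=
  Sum.inr (j, Sum.inl (Sum.inl s))

def cknob (C : Fin m → Fin 3 → Fin n × Bool) (j : Fin m) (t : Fin 3) : GV C :=
  Sum.inr (j, Sum.inl (Sum.inr t))

def cctr (C : Fin m → Fin 3 → Fin n × Bool) (j : Fin m) : GV C := Sum.inr (j, Sum.inr ())

/-- The edges of weight `2.5` inside the variable gadgets: triangle edges, chain edges,
the two pendant edges, and inverter edges. -/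
def varRel (C : Fin m → Fin 3 → Fin n × Bool) (a b : GV C) : Prop :=
  (∃ (i : Fin n) (k : Fin (hocc C i)) (x y : Fin 3),
      x ≠ y ∧ a = vtri C i k x ∧ b = vtri C i k y) ∨
  (∃ (i : Fin n) (k k' : Fin (hocc C i)),
      k'.val = k.val + 1 ∧ a = vtri C i k 1 ∧ b = vtri C i k' 0) ∨
  (∃ (i : Fin n) (k : Fin (hocc C i)), k.val = 0 ∧ a = vpend C i false ∧ b = vtri C i k 0) ∨
  (∃ (i : Fin n) (k : Fin (hocc C i)),
      k.val + 1 = hocc C i ∧ a = vpend C i true ∧ b = vtri C i k 1) ∨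
  (∃ (i : Fin n) (k : Fin (hocc C i))
      (hk : (C ((occs C i).get k).1 ((occs C i).get k).2).2 = false),
      a = vinv C i k hk ∧ b = vtri C i k 2)

/-- The handle edges, of weight `2.5`: knob `c_{j,t}` is attached to cycle vertex `3t`. -/
def handleRel (C : Fin m → Fin 3 → Fin n × Bool) (a b : GV C) : Prop :=
  ∃ (j : Fin m) (t : Fin 3), a = cknob C j t ∧ b = ccyc C j ⟨3 * t.val, by omega⟩

/-- The nonagon edges, of weight `3.6`. -/
def cycleRel (C : Fin m → Fin 3 → Fin n × Bool) (a b : GV C) : Prop :=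
  ∃ (j : Fin m) (s : Fin 9), a = ccyc C j s ∧ b = ccyc C j (s + 1)

/-- The centre edges, of weight `6`. -/
def centreRel (C : Fin m → Fin 3 → Fin n × Bool) (a b : GV C) : Prop :=
  ∃ (j : Fin m) (s : Fin 9), a = cctr C j ∧ b = ccyc C j s

/-- The clause-variable edges, of weight `D`: the knob `c_{j,t}` is joined to the base
vertex of the triangle of the corresponding occurrence of the variable `(C j t).1` if the
literal is positive, and to the inverter of that triangle if the literal is negated. -/
def cvRel (C : Fin m → Fin 3 → Fin n × Bool) (a b : GV C) : Prop :=
  ∃ (j : Fin m) (t : Fin 3) (k : Fin (hocc C (C j t).1)),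
    (occs C (C j t).1).get k = (j, t) ∧ a = cknob C j t ∧
    ((∃ (hk : (C ((occs C (C j t).1).get k).1 ((occs C (C j t).1).get k).2).2 = false),
        b = vinv C (C j t).1 k hk) ∨
      ((C j t).2 = true ∧ b = vtri C (C j t).1 k 2))

/-- The shortcut edges, of weight `2D`: between vertices of different variable gadgets, of
different clause gadgets, or of a variable gadget and a clause gadget not involving that
variable. -/
def shortRel (C : Fin m → Fin 3 → Fin n × Bool) (a b : GV C) : Prop :=
  (∃ (i i' : Fin n) (x : VarV C i) (y : VarV C i'),
      i ≠ i' ∧ a = Sum.inl ⟨i, x⟩ ∧ b = Sum.inl ⟨i', y⟩) ∨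
  (∃ (j j' : Fin m) (x y : ClauseV),
      j ≠ j' ∧ a = Sum.inr (j, x) ∧ b = Sum.inr (j', y)) ∨
  (∃ (i : Fin n) (x : VarV C i) (j : Fin m) (y : ClauseV), (∀ t, (C j t).1 ≠ i) ∧
      a = Sum.inl ⟨i, x⟩ ∧ b = Sum.inr (j, y))

/-- The graph `G_α`. -/
def Galpha (C : Fin m → Fin 3 → Fin n × Bool) : SimpleGraph (GV C) :=
  SimpleGraph.fromRel (fun a b =>
    varRel C a b ∨ handleRel C a b ∨ cycleRel C a b ∨ centreRel C a b ∨
    cvRel C a b ∨ shortRel C a b)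

open Classical in
/-- The weight function of `G_α`, with `D = 5m + 20`. -/
noncomputable def ωα (C : Fin m → Fin 3 → Fin n × Bool) : GV C → GV C → ℝ := fun a b =>
  if varRel C a b ∨ varRel C b a ∨ handleRel C a b ∨ handleRel C b a then 2.5
  else if cycleRel C a b ∨ cycleRel C b a then 3.6
  else if centreRel C a b ∨ centreRel C b a then 6
  else if cvRel C a b ∨ cvRel C b a then 5 * m + 20
  else if shortRel C a b ∨ shortRel C b a then 2 * (5 * m + 20)
  else 0

/-- The assignment `ψ` satisfies the formula: each clause has a true literal. -/
def Satisfies (C : Fin m → Fin 3 → Fin n × Bool) (ψ : Fin n → Bool) : Prop :=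
  ∀ j : Fin m, ∃ t : Fin 3, (if (C j t).2 then ψ (C j t).1 else !(ψ (C j t).1)) = true

/-- Each variable appears at most once per clause. -/
def DistinctVars (C : Fin m → Fin 3 → Fin n × Bool) : Prop :=
  ∀ (j : Fin m) (t t' : Fin 3), (C j t).1 = (C j t').1 → t = t'

/-- The gadget containing a vertex. -/
def gadget (C : Fin m → Fin 3 → Fin n × Bool) (a : GV C) : Fin n ⊕ Fin m :=
  Sum.map Sigma.fst Prod.fst a

/-- The gadget containing the clause-variable neighbours of a vertex, where these can exist. -/
def partner (C : Fin m → Fin 3 → Fin n × Bool) : GV C → Option (Fin n ⊕ Fin m)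
  | Sum.inl ⟨i, Sum.inl (k, _)⟩ => some (Sum.inr ((occs C i).get k).1)
  | Sum.inl ⟨_, Sum.inr (Sum.inl _)⟩ => none
  | Sum.inl ⟨i, Sum.inr (Sum.inr k)⟩ => some (Sum.inr ((occs C i).get k.1).1)
  | Sum.inr (j, Sum.inl (Sum.inr t)) => some (Sum.inl (C j t).1)
  | Sum.inr _ => none

section Structure

variable {C : Fin m → Fin 3 → Fin n × Bool} {a b c : GV C}

lemma gadget_eq_of_varRel (h : varRel C a b) : gadget C a = gadget C b := by
  rcases h with ⟨i, k, x, y, -, rfl, rfl⟩ | ⟨i, k, k', -, rfl, rfl⟩ | ⟨i, k, -, rfl, rfl⟩ |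
    ⟨i, k, -, rfl, rfl⟩ | ⟨i, k, hk, rfl, rfl⟩ <;> rfl

lemma gadget_eq_of_handleRel (h : handleRel C a b) : gadget C a = gadget C b := by
  obtain ⟨j, t, rfl, rfl⟩ := h; rfl

lemma gadget_eq_of_cycleRel (h : cycleRel C a b) : gadget C a = gadget C b := by
  obtain ⟨j, s, rfl, rfl⟩ := h; rfl

lemma gadget_eq_of_centreRel (h : centreRel C a b) : gadget C a = gadget C b := by
  obtain ⟨j, s, rfl, rfl⟩ := h; rfl

lemma gadget_of_cvRel (h : cvRel C a b) :
    ∃ j t, gadget C a = Sum.inr j ∧ gadget C b = Sum.inl (C j t).1 := by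
  obtain ⟨j, t, k, -, rfl, ⟨hk, rfl⟩ | ⟨-, rfl⟩⟩ := h <;> exact ⟨j, t, rfl, rfl⟩

lemma partner_of_cvRel (h : cvRel C a b) :
    partner C a = some (gadget C b) ∧ partner C b = some (gadget C a) := by
  obtain ⟨j, t, k, hk, rfl, ⟨hk', rfl⟩ | ⟨-, rfl⟩⟩ := h <;>
  · refine ⟨rfl, ?_⟩
    change some (Sum.inr ((occs C (C j t).1).get k).1) = some (Sum.inr j)
    rw [hk]

lemma shortRel_iff : shortRel C a b ↔
    (∃ i i', i ≠ i' ∧ gadget C a = Sum.inl i ∧ gadget C b = Sum.inl i') ∨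
    (∃ j j', j ≠ j' ∧ gadget C a = Sum.inr j ∧ gadget C b = Sum.inr j') ∨
    (∃ i j, (∀ t, (C j t).1 ≠ i) ∧ gadget C a = Sum.inl i ∧ gadget C b = Sum.inr j) := by
  constructor
  · rintro (⟨i, i', x, y, h, rfl, rfl⟩ | ⟨j, j', x, y, h, rfl, rfl⟩ | ⟨i, x, j, y, h, rfl, rfl⟩)
    · exact Or.inl ⟨i, i', h, rfl, rfl⟩
    · exact Or.inr (Or.inl ⟨j, j', h, rfl, rfl⟩)
    · exact Or.inr (Or.inr ⟨i, j, h, rfl, rfl⟩)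
  · rcases a with ⟨i₀, x⟩ | ⟨j₀, x⟩ <;> rcases b with ⟨i₁, y⟩ | ⟨j₁, y⟩ <;>
      rintro (⟨i, i', h, h₁, h₂⟩ | ⟨j, j', h, h₁, h₂⟩ | ⟨i, j, h, h₁, h₂⟩) <;>
      cases h₁ <;> cases h₂
    · exact Or.inl ⟨i₀, i₁, x, y, h, rfl, rfl⟩
    · exact Or.inr (Or.inr ⟨i₀, x, j₁, y, h, rfl, rfl⟩)
    · exact Or.inr (Or.inl ⟨j₀, j₁, x, y, h, rfl, rfl⟩)

/-- The endpoints are joined by a shortcut edge, in either orientation. -/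
def ShortAdj (C : Fin m → Fin 3 → Fin n × Bool) (a b : GV C) : Prop :=
  shortRel C a b ∨ shortRel C b a

/-- The endpoints are joined by a clause-variable edge, in either orientation. -/
def CvAdj (C : Fin m → Fin 3 → Fin n × Bool) (a b : GV C) : Prop :=
  cvRel C a b ∨ cvRel C b a

lemma ShortAdj.congr_left (h : ShortAdj C a c) (hg : gadget C a = gadget C b) :
    ShortAdj C b c := by
  simpa only [ShortAdj, shortRel_iff, hg] using h

lemma ShortAdj.gadget_ne (h : ShortAdj C a b) : gadget C a ≠ gadget C b := by
  simp only [ShortAdj, shortRel_iff] at h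
  intro hg
  rw [hg] at h
  rcases h with (⟨i, i', h, h₁, h₂⟩ | ⟨j, j', h, h₁, h₂⟩ | ⟨i, j, h, h₁, h₂⟩) |
    (⟨i, i', h, h₁, h₂⟩ | ⟨j, j', h, h₁, h₂⟩ | ⟨i, j, h, h₁, h₂⟩) <;> simp_all

lemma CvAdj.gadget_ne (h : CvAdj C a b) : gadget C a ≠ gadget C b := by
  rcases h with h | h <;> obtain ⟨j, t, h₁, h₂⟩ := gadget_of_cvRel h <;> simp [h₁, h₂]

lemma CvAdj.gadget_ne_of_shortAdj (h : CvAdj C a b) (hs : ShortAdj C a c) :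
    gadget C b ≠ gadget C c := by
  simp only [ShortAdj, shortRel_iff] at hs
  intro hg
  rw [← hg] at hs
  rcases h with h | h <;> obtain ⟨j, t, h₁, h₂⟩ := gadget_of_cvRel h <;>
    simp only [h₁, h₂] at hs <;> simp at hs
  all_goals exact hs t rfl

lemma CvAdj.gadget_eq (h : CvAdj C a b) (h' : CvAdj C b c) : gadget C a = gadget C c := by
  have h₁ : partner C b = some (gadget C a) :=
    h.elim (fun h ↦ (partner_of_cvRel h).2) (fun h ↦ (partner_of_cvRel h).1)
  have h₂ : partner C b = some (gadget C c) :=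
    h'.elim (fun h ↦ (partner_of_cvRel h).1) (fun h ↦ (partner_of_cvRel h).2)
  exact Option.some.inj (h₁.symm.trans h₂)

lemma adj_iff : (Galpha C).Adj a b ↔ a ≠ b ∧
    ((varRel C a b ∨ varRel C b a ∨ handleRel C a b ∨ handleRel C b a) ∨
      (cycleRel C a b ∨ cycleRel C b a) ∨ (centreRel C a b ∨ centreRel C b a) ∨
      CvAdj C a b ∨ ShortAdj C a b) := by
  rw [Galpha, SimpleGraph.fromRel_adj, CvAdj, ShortAdj]
  tauto

lemma gadget_eq_of_light
    (h : (varRel C a b ∨ varRel C b a ∨ handleRel C a b ∨ handleRel C b a) ∨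
      (cycleRel C a b ∨ cycleRel C b a) ∨ (centreRel C a b ∨ centreRel C b a)) :
    gadget C a = gadget C b := by
  rcases h with (h | h | h | h) | (h | h) | (h | h)
  · exact gadget_eq_of_varRel h
  · exact (gadget_eq_of_varRel h).symm
  · exact gadget_eq_of_handleRel h
  · exact (gadget_eq_of_handleRel h).symm
  · exact gadget_eq_of_cycleRel h
  · exact (gadget_eq_of_cycleRel h).symm
  · exact gadget_eq_of_centreRel h
  · exact (gadget_eq_of_centreRel h).symm

lemma gadget_eq_or_cvAdj_or_shortAdj (h : (Galpha C).Adj a b) :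
    gadget C a = gadget C b ∨ CvAdj C a b ∨ ShortAdj C a b := by
  rcases (adj_iff.1 h).2 with h | h | h | h | h
  · exact Or.inl (gadget_eq_of_light (Or.inl h))
  · exact Or.inl (gadget_eq_of_light (Or.inr (Or.inl h)))
  · exact Or.inl (gadget_eq_of_light (Or.inr (Or.inr h)))
  · exact Or.inr (Or.inl h)
  · exact Or.inr (Or.inr h)

end Structure

section Weights

variable {V : Type*} {G : SimpleGraph V} {w : V → V → ℝ} {u v : V}

lemma wWeight_nil : wWeight w (Walk.nil : G.Walk u u) = 0 := rfl

lemma wWeight_cons {a : V} (h : G.Adj u a) (p : G.Walk a v) :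
    wWeight w (Walk.cons h p) = w u a + wWeight w p := by
  simp [wWeight]

lemma wWeight_nonneg (hw : ∀ a b, G.Adj a b → 0 < w a b) (p : G.Walk u v) :
    0 ≤ wWeight w p := by
  induction p with
  | nil => exact wWeight_nil.ge
  | cons h p ih => rw [wWeight_cons]; linarith [hw _ _ h]

lemma isShortestPath_edge_iff (h : G.Adj u v) :
    IsShortestPath w (Walk.cons h Walk.nil) ↔ ∀ q : G.Walk u v, w u v ≤ wWeight w q := by
  simp [IsShortestPath, wWeight_cons, wWeight_nil, h.ne]

end Weights

section LowerBounds

variable {C : Fin m → Fin 3 → Fin n × Bool} {w : GV C → GV C → ℝ} {D : ℝ} {u v : GV C}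

lemma le_wWeight_of_gadget_ne (hw : ∀ a b, (Galpha C).Adj a b → 0 < w a b) (hD : 0 ≤ D)
    (hcv : ∀ a b, CvAdj C a b → D ≤ w a b) (hs : ∀ a b, ShortAdj C a b → 2 * D ≤ w a b)
    (q : (Galpha C).Walk u v) (hg : gadget C u ≠ gadget C v) : D ≤ wWeight w q := by
  induction q with
  | nil => exact absurd rfl hg
  | cons h p ih =>
    rw [wWeight_cons]
    have hp := wWeight_nonneg hw p
    rcases gadget_eq_or_cvAdj_or_shortAdj h with hi | hi | hi
    · linarith [ih (hi ▸ hg), hw _ _ h]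
    · linarith [hcv _ _ hi]
    · linarith [hs _ _ hi]

/-- A vertex with a clause-variable neighbour outside the target gadget has no clause-variable
neighbour inside it. -/
lemma lt_wWeight_of_cvAdj (hw : ∀ a b, (Galpha C).Adj a b → 0 < w a b) (hD : 0 < D)
    (hcv : ∀ a b, CvAdj C a b → D ≤ w a b) (hs : ∀ a b, ShortAdj C a b → 2 * D ≤ w a b)
    (q : (Galpha C).Walk u v) (hg : gadget C u ≠ gadget C v) {a : GV C} (ha : CvAdj C a u)
    (hav : gadget C a ≠ gadget C v) : D < wWeight w q := by
  cases q with
  | nil => exact absurd rfl hg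
  | cons h p =>
    rw [wWeight_cons]
    have hp := wWeight_nonneg hw p
    rcases gadget_eq_or_cvAdj_or_shortAdj h with hi | hi | hi
    · linarith [le_wWeight_of_gadget_ne hw hD.le hcv hs p (hi ▸ hg), hw _ _ h]
    · linarith [le_wWeight_of_gadget_ne hw hD.le hcv hs p (ha.gadget_eq hi ▸ hav), hcv _ _ hi]
    · linarith [hs _ _ hi]

lemma lt_wWeight_of_shortAdj (hw : ∀ a b, (Galpha C).Adj a b → 0 < w a b) (hD : 0 < D)
    (hcv : ∀ a b, CvAdj C a b → D ≤ w a b) (hs : ∀ a b, ShortAdj C a b → w a b = 2 * D)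
    (q : (Galpha C).Walk u v) (huv : ShortAdj C u v) :
    (∃ h, q = Walk.cons h Walk.nil) ∨ 2 * D < wWeight w q := by
  have hs' : ∀ a b, ShortAdj C a b → 2 * D ≤ w a b := fun a b h ↦ (hs a b h).ge
  induction q with
  | nil => exact absurd rfl huv.gadget_ne
  | @cons a b c h p ih =>
    rcases gadget_eq_or_cvAdj_or_shortAdj h with hi | hi | hi
    · right
      have hbc := huv.congr_left hi
      rw [wWeight_cons]
      rcases ih hbc with ⟨h', rfl⟩ | hp
      · rw [wWeight_cons, wWeight_nil]
        linarith [hs' _ _ hbc, hw _ _ h]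
      · linarith [hw _ _ h]
    · right
      rw [wWeight_cons]
      linarith [hcv _ _ hi, lt_wWeight_of_cvAdj hw hD hcv hs' p
        (hi.gadget_ne_of_shortAdj huv) hi huv.gadget_ne]
    · cases p with
      | nil => exact Or.inl ⟨h, rfl⟩
      | cons h' p =>
        right
        rw [wWeight_cons, wWeight_cons]
        linarith [hs _ _ hi, hw _ _ h', wWeight_nonneg hw p]

lemma unique_isShortestPath_of_shortAdj (hw : ∀ a b, (Galpha C).Adj a b → 0 < w a b)
    (hD : 0 < D) (hcv : ∀ a b, CvAdj C a b → D ≤ w a b)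
    (hs : ∀ a b, ShortAdj C a b → w a b = 2 * D) (huv : ShortAdj C u v)
    (hadj : (Galpha C).Adj u v) :
    IsShortestPath w (Walk.cons hadj Walk.nil) ∧
      ∀ q : (Galpha C).Walk u v, IsShortestPath w q → q = Walk.cons hadj Walk.nil := by
  constructor
  · rw [isShortestPath_edge_iff]
    intro q
    rcases lt_wWeight_of_shortAdj hw hD hcv hs q huv with ⟨h, rfl⟩ | h
    · simp [wWeight_cons, wWeight_nil]
    · linarith [hs _ _ huv]
  · intro q hq
    rcases lt_wWeight_of_shortAdj hw hD hcv hs q huv with ⟨h, rfl⟩ | h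
    · rfl
    · have := hq.2 (Walk.cons hadj Walk.nil)
      rw [wWeight_cons, wWeight_nil, hs _ _ huv] at this
      linarith

end LowerBounds

section OriginalWeights

variable {C : Fin m → Fin 3 → Fin n × Bool} {a b : GV C}

lemma ωα_of_cvAdj (h : CvAdj C a b) : ωα C a b = 5 * m + 20 := by
  obtain ⟨h₁, h₂₃⟩ := not_or.1 (mt gadget_eq_of_light h.gadget_ne)
  obtain ⟨h₂, h₃⟩ := not_or.1 h₂₃
  rw [ωα, if_neg h₁, if_neg h₂, if_neg h₃]
  exact if_pos h

lemma ωα_of_shortAdj (h : ShortAdj C a b) : ωα C a b = 2 * (5 * m + 20) := by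
  obtain ⟨h₁, h₂₃⟩ := not_or.1 (mt gadget_eq_of_light h.gadget_ne)
  obtain ⟨h₂, h₃⟩ := not_or.1 h₂₃
  have hcv : ¬ CvAdj C a b := fun hcv ↦ hcv.gadget_ne_of_shortAdj h rfl
  rw [ωα, if_neg h₁, if_neg h₂, if_neg h₃]
  exact (if_neg hcv).trans (if_pos h)

lemma le_ωα (h : (Galpha C).Adj a b) : 2.5 ≤ ωα C a b := by
  have hm : (0 : ℝ) ≤ m := m.cast_nonneg
  have := (adj_iff.1 h).2
  unfold CvAdj ShortAdj at this
  unfold ωα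
  split_ifs <;> first | linarith | tauto

lemma ωα_pos (a b : GV C) (h : (Galpha C).Adj a b) : 0 < ωα C a b := by
  linarith [le_ωα h]

lemma six_le_ωα_centre {j : Fin m} (h : (Galpha C).Adj (cctr C j) b) :
    6 ≤ ωα C (cctr C j) b := by
  have hm : (0 : ℝ) ≤ m := m.cast_nonneg
  have h₁ : ¬ (varRel C (cctr C j) b ∨ varRel C b (cctr C j) ∨ handleRel C (cctr C j) b ∨
      handleRel C b (cctr C j)) := by
    rintro (h | h | h | h)
    · rcases h with ⟨_, _, _, _, _, h, _⟩ | ⟨_, _, _, _, h, _⟩ | ⟨_, _, _, h, _⟩ |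
        ⟨_, _, _, h, _⟩ | ⟨_, _, _, h, _⟩ <;> cases h
    · rcases h with ⟨_, _, _, _, _, _, h⟩ | ⟨_, _, _, _, _, h⟩ | ⟨_, _, _, _, h⟩ |
        ⟨_, _, _, _, h⟩ | ⟨_, _, _, _, h⟩ <;> cases h
    · obtain ⟨_, _, h, _⟩ := h; cases h
    · obtain ⟨_, _, _, h⟩ := h; cases h
  have h₂ : ¬ (cycleRel C (cctr C j) b ∨ cycleRel C b (cctr C j)) := by
    rintro (⟨_, _, h, _⟩ | ⟨_, _, _, h⟩) <;> cases h
  have := (adj_iff.1 h).2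
  unfold CvAdj ShortAdj at this
  unfold ωα
  split_ifs <;> first | linarith | tauto

lemma isShortestPath_of_le {V : Type*} {G : SimpleGraph V} {w : V → V → ℝ} {u v : V}
    (hw : ∀ a b, G.Adj a b → 0 < w a b) (hu : ∀ a, G.Adj u a → w u v ≤ w u a)
    (h : G.Adj u v) : IsShortestPath w (Walk.cons h Walk.nil) := by
  rw [isShortestPath_edge_iff]
  intro q
  cases q with
  | nil => exact absurd rfl h.ne
  | cons h' p =>
    rw [wWeight_cons]
    linarith [hu _ h', wWeight_nonneg hw p]

/-- Every edge is a shortest path, in at least one orientation. -/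
lemma isShortestPath_edge (h : (Galpha C).Adj a b) :
    IsShortestPath (ωα C) (Walk.cons h Walk.nil) ∨
      IsShortestPath (ωα C) (Walk.cons h.symm Walk.nil) := by
  have hm : (0 : ℝ) ≤ m := m.cast_nonneg
  have hD : (0 : ℝ) < 5 * m + 20 := by positivity
  rcases (adj_iff.1 h).2 with hi | hi | hi | hi | hi
  · left
    refine isShortestPath_of_le ωα_pos (fun c hc ↦ ?_) h
    have : ωα C a b = 2.5 := if_pos hi
    linarith [le_ωα hc]
  · left
    rw [isShortestPath_edge_iff]
    have hab : ωα C a b ≤ 3.6 := by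
      unfold ωα
      split_ifs
      all_goals norm_num
    intro q
    cases q with
    | nil => exact absurd rfl h.ne
    | cons h₁ p =>
      cases p with
      | nil => simp [wWeight_cons, wWeight_nil]
      | cons h₂ p =>
        rw [wWeight_cons, wWeight_cons]
        linarith [le_ωα h₁, le_ωα h₂, wWeight_nonneg ωα_pos p]
  · have key : ∀ {a b : GV C} (h : (Galpha C).Adj a b), centreRel C a b →
        IsShortestPath (ωα C) (Walk.cons h Walk.nil) := by
      intro a b h hc
      have hab : ωα C a b ≤ 6 := by
        unfold ωα
        split_ifs
        all_goals first | tauto | norm_num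
      refine isShortestPath_of_le ωα_pos (fun c h' ↦ hab.trans ?_) h
      obtain ⟨j, s, rfl, rfl⟩ := hc
      exact six_le_ωα_centre h'
    exact hi.imp (key h) (key h.symm)
  · left
    rw [isShortestPath_edge_iff]
    intro q
    rw [ωα_of_cvAdj hi]
    exact le_wWeight_of_gadget_ne ωα_pos hD.le (fun _ _ h ↦ (ωα_of_cvAdj h).ge)
      (fun _ _ h ↦ (ωα_of_shortAdj h).ge) q hi.gadget_ne
  · exact Or.inl (unique_isShortestPath_of_shortAdj ωα_pos hD (fun _ _ h ↦ (ωα_of_cvAdj h).ge)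
      (fun _ _ h ↦ ωα_of_shortAdj h) hi h).1

end OriginalWeights

section RoundedWeights

variable {C : Fin m → Fin 3 → Fin n × Bool} {wt : GV C → GV C → ℕ} {a b : GV C}

lemma ωα_comm (a b : GV C) : ωα C a b = ωα C b a := by
  unfold ωα
  split_ifs <;> first | rfl | tauto

lemma abs_sub_ωα_lt_one (hwts : ∀ a b, wt a b = wt b a)
    (hround : PathObliviousRounding (Galpha C) (ωα C) wt 1) (h : (Galpha C).Adj a b) :
    |(wt a b : ℝ) - ωα C a b| < 1 := by
  rcases isShortestPath_edge h with hp | hp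
  · simpa only [wWeight_cons, wWeight_nil, add_zero] using hround _ _ _ hp
  · rw [hwts, ωα_comm]
    simpa only [wWeight_cons, wWeight_nil, add_zero] using hround _ _ _ hp

lemma natCast_eq_of_abs_sub_lt_one {x y : ℕ} (h : |(x : ℝ) - y| < 1) : x = y := by
  have : |(x : ℤ) - y| < 1 := by exact_mod_cast h
  rw [Int.abs_lt_one_iff] at this
  omega

end RoundedWeights

/-- If `u` and `v` are vertices of `G_α` directly connected by a shortcut edge and `wt` is any
path-oblivious `1`-rounding of `G_α`, then the single-edge path consisting of the shortcut
edge `{u, v}` is the unique shortest path from `u` to `v` in `G_α`, both with respect to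
the original weights `ωα` and with respect to the rounded weights `wt`. -/
theorem shortcut_edge_unique_shortest_path {n m : ℕ}
    (C : Fin m → Fin 3 → Fin n × Bool) (hdist : DistinctVars C)
    (u v : GV C) (hshort : shortRel C u v ∨ shortRel C v u)
    (hadj : (Galpha C).Adj u v)
    (wt : GV C → GV C → ℕ) (hwts : ∀ a b, wt a b = wt b a)
    (hround : PathObliviousRounding (Galpha C) (ωα C) wt 1) :
    (IsShortestPath (ωα C) (Walk.cons hadj Walk.nil) ∧
      ∀ q : (Galpha C).Walk u v, IsShortestPath (ωα C) q → q = Walk.cons hadj Walk.nil) ∧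
    (IsShortestPath (fun a b => (wt a b : ℝ)) (Walk.cons hadj Walk.nil) ∧
      ∀ q : (Galpha C).Walk u v, IsShortestPath (fun a b => (wt a b : ℝ)) q →
        q = Walk.cons hadj Walk.nil) := by
  have hD : (0 : ℝ) < 5 * m + 20 := by positivity
  have hclose {a b : GV C} := abs_sub_ωα_lt_one (a := a) (b := b) hwts hround
  refine ⟨unique_isShortestPath_of_shortAdj ωα_pos hD (fun _ _ h ↦ (ωα_of_cvAdj h).ge)
      (fun _ _ h ↦ ωα_of_shortAdj h) hshort hadj,
    unique_isShortestPath_of_shortAdj (D := 5 * m + 20) (fun a b h ↦ ?_) hD (fun a b h ↦ ?_)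
      (fun a b h ↦ ?_) hshort hadj⟩
  · linarith [le_ωα h, (abs_lt.1 (hclose h)).1]
  · have hab := hclose (adj_iff.2 ⟨fun e ↦ h.gadget_ne (congrArg _ e),
      Or.inr (Or.inr (Or.inr (Or.inl h)))⟩)
    rw [ωα_of_cvAdj h] at hab
    have : wt a b = 5 * m + 20 := natCast_eq_of_abs_sub_lt_one (by exact_mod_cast hab)
    exact (by exact_mod_cast this : (wt a b : ℝ) = 5 * m + 20).ge
  · have hab := hclose (adj_iff.2 ⟨fun e ↦ h.gadget_ne (congrArg _ e),
      Or.inr (Or.inr (Or.inr (Or.inr h)))⟩)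
    rw [ωα_of_shortAdj h] at hab
    have : wt a b = 2 * (5 * m + 20) := natCast_eq_of_abs_sub_lt_one (by exact_mod_cast hab)
    exact_mod_cast this
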